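/- arXiv:math/0209340 — 2 statements merged into one kernel-verified Lean document; each statement's English description precedes it below -/
import Mathlib

section
/- For m ≥ 2 and 1 ≤ i,j ≤ m with i ≠ j, let c(m;i,j) denote the number of permutations of length m that avoid both 132 and 312 as consecutive patterns and satisfy π_1 = i and π_2 = j (and set c(m;i,i) = 0, which agrees with the count). Then for all n ≥ 3 and all 1 ≤ i,j ≤ n with i ≠ j: if i > j then c(n;i,j) = ∑_{k=1}^{j-1} c(n-1;j,k) + ∑_{k=i}^{n-1} c(n-1;j,k), and if i < j then c(n;i,j) = ∑_{k=1}^{i-1} c(n-1;j-1,k) + ∑_{k=j}^{n-1} c(n-1;j-1,k). Consequently the number of permutations of length n avoiding both 132 and 312 as consecutive patterns equals ∑_{1≤i,j≤n} c(n;i,j). -/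
/-- `π` avoids 132 as a consecutive pattern: no three adjacent letters are
order-isomorphic to 132. -/
def Avoids132Cons {n : ℕ} (π : Equiv.Perm (Fin n)) : Prop :=
  ∀ i : ℕ, ∀ h : i + 2 < n,
    ¬ (π ⟨i, by omega⟩ < π ⟨i + 2, h⟩ ∧ π ⟨i + 2, h⟩ < π ⟨i + 1, by omega⟩)

/-- `π` avoids 312 as a consecutive pattern: no three adjacent letters are
order-isomorphic to 312. -/
def Avoids312Cons {n : ℕ} (π : Equiv.Perm (Fin n)) : Prop :=
  ∀ i : ℕ, ∀ h : i + 2 < n,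
    ¬ (π ⟨i + 1, by omega⟩ < π ⟨i + 2, h⟩ ∧ π ⟨i + 2, h⟩ < π ⟨i, by omega⟩)

/-- `c m i j` is the number of permutations of length `m` avoiding both 132 and 312
as consecutive patterns with first letter `i` and second letter `j`
(letters being `1, …, m`); note this is `0` when `i = j`. -/
noncomputable def c (m i j : ℕ) : ℕ :=
  Nat.card {π : Equiv.Perm (Fin m) //
    (Avoids132Cons π ∧ Avoids312Cons π) ∧
    ∃ h : 1 < m, ((π ⟨0, by omega⟩ : Fin m) : ℕ) + 1 = i ∧ ((π ⟨1, h⟩ : Fin m) : ℕ) + 1 = j}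

open Finset in
theorem c_eq (m i j : ℕ) [DecidablePred fun π : Equiv.Perm (Fin (m+2)) => (Avoids132Cons π ∧ Avoids312Cons π) ∧ (π 0).val + 1 = i ∧ (π 1).val + 1 = j] :
    c (m+2) i j = (univ.filter fun π : Equiv.Perm (Fin (m+2)) =>
      (Avoids132Cons π ∧ Avoids312Cons π) ∧ (π 0).val + 1 = i ∧ (π 1).val + 1 = j).card := by
  unfold c
  rw [← Fintype.card_subtype, ← Nat.card_eq_fintype_card]
  apply Nat.card_congr
  apply Equiv.subtypeEquivRight
  intro π
  constructor
  · rintro ⟨h, _, h1, h2⟩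
    exact ⟨h, h1, h2⟩
  · rintro ⟨h, h1, h2⟩
    exact ⟨h, by omega, h1, h2⟩

open Finset Classical in
theorem sum_c (m j : ℕ) (S : Finset ℕ) :
    ∑ k ∈ S, c (m+2) j k = (univ.filter fun π : Equiv.Perm (Fin (m+2)) =>
      (Avoids132Cons π ∧ Avoids312Cons π) ∧ (π 0).val + 1 = j ∧ (π 1).val + 1 ∈ S).card := by
  rw [card_eq_sum_card_fiberwise (f := fun π : Equiv.Perm (Fin (m+2)) => (π 1).val + 1) (t := S)]
  · apply sum_congr rfl
    intro k hk
    rw [c_eq, filter_filter]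
    congr 1
    apply filter_congr
    intro π _
    constructor
    · rintro ⟨h, h1, h2⟩
      exact ⟨⟨h, h1, h2 ▸ hk⟩, h2⟩
    · rintro ⟨⟨h, h1, _⟩, h2⟩
      exact ⟨h, h1, h2⟩
  · intro π hπ
    simp at hπ
    simpa using hπ.2.2

/-- insert first letter `p` -/
def ins {n : ℕ} (p : Fin (n+1)) (σ : Equiv.Perm (Fin n)) : Equiv.Perm (Fin (n+1)) :=
  ((finSuccEquiv' 0).trans (Equiv.optionCongr σ)).trans (finSuccEquiv' p).symm

theorem ins_zero {n : ℕ} (p : Fin (n+1)) (σ : Equiv.Perm (Fin n)) : ins p σ 0 = p := by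
  simp [ins]

theorem ins_succ {n : ℕ} (p : Fin (n+1)) (σ : Equiv.Perm (Fin n)) (x : Fin n) :
    ins p σ x.succ = p.succAbove (σ x) := by
  have : finSuccEquiv' (0 : Fin (n+1)) x.succ = some x := by
    rw [← Fin.succAbove_zero, finSuccEquiv'_succAbove]
  simp [ins, this]

theorem ins_mk {n : ℕ} (p : Fin (n+1)) (σ : Equiv.Perm (Fin n)) (x : ℕ) (h : x + 1 < n + 1) :
    ins p σ ⟨x+1, h⟩ = p.succAbove (σ ⟨x, by omega⟩) := ins_succ p σ ⟨x, by omega⟩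

theorem ins_inj {n : ℕ} (p : Fin (n+1)) (σ τ : Equiv.Perm (Fin n)) (h : ins p σ = ins p τ) :
    σ = τ := by
  ext x
  have := congrArg (fun f => f x.succ) h
  simp only [ins_succ] at this
  rw [Fin.succAbove_right_injective this]

theorem ins_surj {n : ℕ} (π : Equiv.Perm (Fin (n+1))) : ∃ σ, ins (π 0) σ = π := by
  have hx : ∀ x : Fin n, ∃ y, (π 0).succAbove y = π x.succ := by
    intro x
    apply Fin.exists_succAbove_eq
    intro h
    exact Fin.succ_ne_zero x (π.injective h)
  choose f hf using hx
  have hinj : Function.Injective f := by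
    intro x y hxy
    have := hf x
    rw [hxy, hf y] at this
    exact (Fin.succ_injective _ (π.injective this)).symm
  refine ⟨Equiv.ofBijective f (Finite.injective_iff_bijective.mp hinj), ?_⟩
  apply Equiv.ext
  intro x
  refine Fin.cases ?_ (fun y => ?_) x
  · rw [ins_zero]
  · rw [ins_succ]; exact hf y

theorem av_ins {m : ℕ} (p : Fin (m+3)) (σ : Equiv.Perm (Fin (m+2))) :
    (Avoids132Cons (ins p σ) ∧ Avoids312Cons (ins p σ)) ↔ (Avoids132Cons σ ∧ Avoids312Cons σ) ∧
      ¬ (p < p.succAbove (σ 1) ∧ σ 1 < σ 0) ∧ ¬ (σ 0 < σ 1 ∧ p.succAbove (σ 1) < p) := by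
  constructor
  · rintro ⟨h1, h2⟩
    refine ⟨⟨?_, ?_⟩, ?_, ?_⟩
    · intro i h
      have := h1 (i+1) (by omega)
      simpa only [ins_mk, Fin.succAbove_lt_succAbove_iff] using this
    · intro i h
      have := h2 (i+1) (by omega)
      simpa only [ins_mk, Fin.succAbove_lt_succAbove_iff] using this
    · have := h1 0 (by omega)
      rw [ins_mk, ins_mk, Fin.succAbove_lt_succAbove_iff] at this
      have h0 : ins p σ ⟨0, by omega⟩ = p := ins_zero p σ
      rw [h0] at this
      exact this
    · have := h2 0 (by omega)
      rw [ins_mk, ins_mk, Fin.succAbove_lt_succAbove_iff] at this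
      have h0 : ins p σ ⟨0, by omega⟩ = p := ins_zero p σ
      rw [h0] at this
      exact this
  · rintro ⟨⟨h1, h2⟩, h3, h4⟩
    have h0 : ins p σ ⟨0, by omega⟩ = p := ins_zero p σ
    constructor
    · rintro (_ | i) h
      · rw [ins_mk, ins_mk, Fin.succAbove_lt_succAbove_iff, h0]
        exact h3
      · rw [ins_mk, ins_mk, ins_mk, Fin.succAbove_lt_succAbove_iff, Fin.succAbove_lt_succAbove_iff]
        exact h1 i (by omega)
    · rintro (_ | i) h
      · rw [ins_mk, ins_mk, Fin.succAbove_lt_succAbove_iff, h0]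
        exact h4
      · rw [ins_mk, ins_mk, ins_mk, Fin.succAbove_lt_succAbove_iff, Fin.succAbove_lt_succAbove_iff]
        exact h2 i (by omega)

theorem sa_val {n : ℕ} (p : Fin (n+1)) (x : Fin n) :
    (p.succAbove x).val = if x.val < p.val then x.val else x.val + 1 := by
  simp only [Fin.succAbove, Fin.lt_def, Fin.val_castSucc]
  split_ifs <;> simp

open Finset Classical in
theorem c_step (m i j j' : ℕ) (S : Finset ℕ) (hi : 1 ≤ i) (hi' : i ≤ m + 3)
    (hS : ∀ a b, a < m + 2 → b < m + 2 → a ≠ b →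
      ((¬ (i - 1 < (if b < i - 1 then b else b + 1) ∧ b < a) ∧
        ¬ (a < b ∧ (if b < i - 1 then b else b + 1) < i - 1)) ∧
        (if a < i - 1 then a else a + 1) + 1 = j ↔ a + 1 = j' ∧ b + 1 ∈ S)) :
    c (m+3) i j = ∑ k ∈ S, c (m+2) j' k := by
  rw [sum_c, c_eq (m+1)]
  symm
  have key : ∀ σ : Equiv.Perm (Fin (m+2)),
      ((Avoids132Cons (ins ⟨i-1, by omega⟩ σ) ∧ Avoids312Cons (ins ⟨i-1, by omega⟩ σ)) ∧
        (ins ⟨i-1, by omega⟩ σ 0).val + 1 = i ∧ (ins ⟨i-1, by omega⟩ σ 1).val + 1 = j) ↔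
      ((Avoids132Cons σ ∧ Avoids312Cons σ) ∧ (σ 0).val + 1 = j' ∧ (σ 1).val + 1 ∈ S) := by
    intro σ
    have h01 : (σ 0).val ≠ (σ 1).val := by
      intro h
      have := σ.injective (Fin.ext h)
      simp at this
    have h1 : ins ⟨i-1, by omega⟩ σ 1 = Fin.succAbove ⟨i-1, by omega⟩ (σ 0) := ins_succ _ σ 0
    rw [av_ins, ins_zero, h1, ← hS _ _ (σ 0).isLt (σ 1).isLt h01]
    simp only [Fin.lt_def, sa_val]
    have : i - 1 + 1 = i := by omega
    tauto
  apply card_bij (fun σ _ => ins ⟨i-1, by omega⟩ σ)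
  · intro σ h
    rw [mem_filter] at h ⊢
    exact ⟨mem_univ _, (key σ).2 h.2⟩
  · intro σ _ τ _ h
    exact ins_inj _ _ _ h
  · intro π h
    obtain ⟨σ, hσ⟩ := ins_surj π
    rw [mem_filter] at h
    have h0 : π 0 = ⟨i-1, by omega⟩ := by
      apply Fin.ext
      have := h.2.2.1
      simp only
      omega
    rw [h0] at hσ
    refine ⟨σ, ?_, hσ⟩
    rw [mem_filter]
    refine ⟨mem_univ _, (key σ).1 ?_⟩
    rw [hσ]
    exact h.2

open Finset Classical in
theorem total (m : ℕ) :
    Nat.card {π : Equiv.Perm (Fin (m+2)) // Avoids132Cons π ∧ Avoids312Cons π}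
      = ∑ i ∈ Finset.Icc 1 (m+2), ∑ j ∈ Finset.Icc 1 (m+2), c (m+2) i j := by
  rw [Nat.card_eq_fintype_card, Fintype.card_subtype,
    card_eq_sum_card_fiberwise (f := fun π : Equiv.Perm (Fin (m+2)) => (π 0).val + 1)
      (t := Icc 1 (m+2))]
  · apply sum_congr rfl
    intro k hk
    rw [sum_c, filter_filter]
    congr 1
    apply filter_congr
    intro π _
    have : (π 1).val + 1 ∈ Icc 1 (m+2) := by
      rw [mem_Icc]; have := (π 1).isLt; omega
    tauto
  · intro π _
    have := (π 0).isLt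
    simp only [coe_Icc, Set.mem_Icc]
    omega

theorem avoid132_312_recurrence (n : ℕ) (hn : 3 ≤ n) :
    (∀ i j, 1 ≤ i → i ≤ n → 1 ≤ j → j ≤ n → i ≠ j →
      (j < i → c n i j = (∑ k ∈ Finset.Icc 1 (j - 1), c (n - 1) j k)
          + ∑ k ∈ Finset.Icc i (n - 1), c (n - 1) j k) ∧
      (i < j → c n i j = (∑ k ∈ Finset.Icc 1 (i - 1), c (n - 1) (j - 1) k)
          + ∑ k ∈ Finset.Icc j (n - 1), c (n - 1) (j - 1) k)) ∧
    Nat.card {π : Equiv.Perm (Fin n) // Avoids132Cons π ∧ Avoids312Cons π}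
      = ∑ i ∈ Finset.Icc 1 n, ∑ j ∈ Finset.Icc 1 n, c n i j := by
  obtain ⟨m, rfl⟩ : ∃ m, n = m + 3 := ⟨n - 3, by omega⟩
  refine ⟨?_, total (m+1)⟩
  intro i j hi hi' hj hj' hij
  constructor
  · intro h
    rw [← Finset.sum_union]
    · apply c_step m i j j _ hi hi'
      intro a b ha hb hab
      simp only [Finset.mem_union, Finset.mem_Icc]
      split_ifs <;> omega
    · rw [Finset.disjoint_left]
      intro k
      simp only [Finset.mem_Icc]
      omega
  · intro h
    rw [← Finset.sum_union]
    · apply c_step m i j (j-1) _ hi hi'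
      intro a b ha hb hab
      simp only [Finset.mem_union, Finset.mem_Icc]
      split_ifs <;> omega
    · rw [Finset.disjoint_left]
      intro k
      simp only [Finset.mem_Icc]
      omega
end

section
/- For all n ≥ k ≥ 1, the number of permutations of length n that avoid the classical pattern 1-3-2 and begin with the pattern 12⋯k equals the Catalan number C_{n-k+1}. -/
/-- `π` avoids the classical pattern 1-3-2: there are no indices `i < j < k`
with `π i < π k < π j`. -/
def AvoidsC132 {n : ℕ} (π : Equiv.Perm (Fin n)) : Prop :=
  ¬ ∃ i j k : Fin n, i < j ∧ j < k ∧ π i < π k ∧ π k < π j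

/-- `π` begins with the pattern `12⋯k`: its first `k` letters are increasing
(in particular the length is at least `k`). -/
def BeginsInc {n : ℕ} (π : Equiv.Perm (Fin n)) (k : ℕ) : Prop :=
  k ≤ n ∧ ∀ i j : Fin n, i < j → (j : ℕ) < k → π i < π j

def insP {n : ℕ} (a : Fin (n+1)) (σ : Equiv.Perm (Fin n)) : Equiv.Perm (Fin (n+1)) :=
  (finSuccEquiv' 0).trans ((Equiv.optionCongr σ).trans (finSuccEquiv' a).symm)

lemma insP_zero {n : ℕ} (a : Fin (n+1)) (σ : Equiv.Perm (Fin n)) : insP a σ 0 = a := by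
  simp [insP]

lemma insP_succ {n : ℕ} (a : Fin (n+1)) (σ : Equiv.Perm (Fin n)) (i : Fin n) :
    insP a σ i.succ = a.succAbove (σ i) := by
  have : finSuccEquiv' (0 : Fin (n+1)) i.succ = some i := by
    rw [← Fin.succAbove_zero, finSuccEquiv'_succAbove]
  simp [insP, this]

lemma insP_inj {n : ℕ} : Function.Injective
    (fun p : Fin (n+1) × Equiv.Perm (Fin n) => insP p.1 p.2) := by
  rintro ⟨a, σ⟩ ⟨b, τ⟩ h
  simp only at h
  have hab : a = b := by rw [← insP_zero a σ, h, insP_zero]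
  subst hab
  congr 1
  ext i
  have := insP_succ a σ i
  rw [h, insP_succ] at this
  rw [Fin.succAbove_right_injective this]

noncomputable def insE (n : ℕ) : Fin (n+1) × Equiv.Perm (Fin n) ≃ Equiv.Perm (Fin (n+1)) :=
  Equiv.ofBijective _ ((Fintype.bijective_iff_injective_and_card _).2
    ⟨insP_inj, by simp [Fintype.card_perm, Nat.factorial_succ]⟩)

lemma insE_apply {n : ℕ} (p : Fin (n+1) × Equiv.Perm (Fin n)) : insE n p = insP p.1 p.2 := rfl

/-- the entries with value at least `a` are increasing -/
def TopInc {n : ℕ} (σ : Equiv.Perm (Fin n)) (a : ℕ) : Prop :=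
  ∀ i j : Fin n, i < j → a ≤ σ i → a ≤ σ j → σ i < σ j

lemma avoids_insP {n : ℕ} (a : Fin (n+1)) (σ : Equiv.Perm (Fin n)) :
    AvoidsC132 (insP a σ) ↔ AvoidsC132 σ ∧ TopInc σ a := by
  have hlt : ∀ x : Fin n, a < a.succAbove x ↔ (a : ℕ) ≤ x := by
    intro x; rw [Fin.lt_succAbove_iff_le_castSucc]; rfl
  constructor
  · intro h
    constructor
    · rintro ⟨i, j, k, h1, h2, h3, h4⟩
      exact h ⟨i.succ, j.succ, k.succ, by simpa, by simpa, by simpa [insP_succ],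
        by simpa [insP_succ]⟩
    · intro i j hij hi hj
      by_contra hc
      have hne : σ i ≠ σ j := fun e => hij.ne (σ.injective e)
      have : σ j < σ i := lt_of_le_of_ne (not_lt.1 hc) hne.symm
      exact h ⟨0, i.succ, j.succ, by simp, by simpa, by rw [insP_zero, insP_succ, hlt]; exact hj,
        by simpa [insP_succ]⟩
  · rintro ⟨h, ht⟩ ⟨i, j, k, h1, h2, h3, h4⟩
    obtain ⟨j, rfl⟩ := Fin.exists_succ_eq.2 (Fin.ne_zero_of_lt h1)
    obtain ⟨k, rfl⟩ := Fin.exists_succ_eq.2 (Fin.ne_zero_of_lt h2)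
    simp only [insP_succ, Fin.succ_lt_succ_iff, Fin.succAbove_lt_succAbove_iff] at h2 h4
    induction i using Fin.cases with
    | zero =>
      rw [insP_zero, insP_succ, hlt] at h3
      have := ht j k h2 (h3.trans (by exact_mod_cast h4.le)) h3
      exact absurd this (not_lt.2 h4.le)
    | succ i =>
      simp only [insP_succ, Fin.succ_lt_succ_iff, Fin.succAbove_lt_succAbove_iff] at h1 h3
      exact h ⟨i, j, k, h1, h2, h3, h4⟩

lemma topInc_insP {n : ℕ} (a : Fin (n+1)) (σ : Equiv.Perm (Fin n)) (h : TopInc σ a)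
    (b : ℕ) : TopInc (insP a σ) b ↔ (a : ℕ) ≤ b := by
  constructor
  · intro ht
    by_contra hc
    push Not at hc
    have hbn : b < n := by omega
    have h1 := ht 0 (σ.symm ⟨b, hbn⟩).succ (by simp) (by rw [insP_zero]; omega)
    have e : a.succAbove ⟨b, hbn⟩ = (⟨b, hbn⟩ : Fin n).castSucc :=
      Fin.succAbove_of_castSucc_lt _ _ (by simpa [Fin.lt_def] using hc)
    rw [insP_zero, insP_succ, Equiv.apply_symm_apply, e] at h1
    have := h1 le_rfl
    simp only [Fin.lt_def, Fin.val_castSucc] at this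
    omega
  · intro hab i j hij hi hj
    obtain ⟨j, rfl⟩ := Fin.exists_succ_eq.2 (Fin.ne_zero_of_lt hij)
    have key : ∀ x : Fin n, b ≤ (insP a σ x.succ : ℕ) →
        (a : ℕ) ≤ σ x ∧ a < insP a σ x.succ := by
      intro x hx
      have h1 : a ≤ insP a σ x.succ := by rw [Fin.le_def]; omega
      have h2 : a < insP a σ x.succ := by
        refine lt_of_le_of_ne h1 ?_
        rw [insP_succ]; exact (Fin.succAbove_ne _ _).symm
      refine ⟨?_, h2⟩
      rw [insP_succ, Fin.lt_succAbove_iff_le_castSucc] at h2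
      exact h2
    induction i using Fin.cases with
    | zero => rw [insP_zero]; exact (key j hj).2
    | succ i =>
      rw [insP_succ, insP_succ, Fin.succAbove_lt_succAbove_iff]
      exact h i j (by simpa using hij) (key i hi).1 (key j hj).1

open Classical in
noncomputable def DD (n b : ℕ) : ℕ :=
  ∑ σ : Equiv.Perm (Fin n), if AvoidsC132 σ ∧ TopInc σ b then 1 else 0

lemma DD_succ (n b : ℕ) (hb : b ≤ n) : DD (n+1) b = ∑ a ∈ Finset.range (b+1), DD n a := by
  classical
  unfold DD
  rw [← (insE n).sum_comp, Fintype.sum_prod_type]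
  have : ∀ a : Fin (n+1), (∑ σ : Equiv.Perm (Fin n),
      if AvoidsC132 (insE n (a, σ)) ∧ TopInc (insE n (a, σ)) b then 1 else 0)
      = if (a : ℕ) ≤ b then DD n a else 0 := by
    intro a
    simp only [insE_apply, avoids_insP]
    split_ifs with hab
    · unfold DD
      refine Finset.sum_congr rfl fun σ _ => if_congr ?_ rfl rfl
      constructor
      · rintro ⟨h, -⟩; exact h
      · intro h; exact ⟨h, (topInc_insP a σ h.2 b).2 hab⟩
    · refine Finset.sum_eq_zero fun σ _ => if_neg ?_
      rintro ⟨h, h'⟩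
      exact hab ((topInc_insP a σ h.2 b).1 h')
  rw [Finset.sum_congr rfl fun a _ => this a,
    Fin.sum_univ_eq_sum_range (fun a => if a ≤ b then DD n a else 0) (n+1), ← Finset.sum_filter]
  refine Finset.sum_congr ?_ fun _ _ => rfl
  ext x; simp; omega

lemma DD_top (n : ℕ) : DD (n+1) (n+1) = DD (n+1) n := by
  classical
  unfold DD
  refine Finset.sum_congr rfl fun σ _ => if_congr (and_congr_right fun _ => ?_) rfl rfl
  constructor
  · intro _ i j hij hi hj
    have h1 := (σ i).2
    have h2 := (σ j).2
    exact absurd (σ.injective (Fin.ext (by omega))) hij.ne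
  · intro _ i j hij hi
    have h1 := (σ i).2
    omega

def BB (n : ℕ) : ℕ → ℤ
  | 0 => 1
  | a+1 => ((n+a+1).choose (a+1) : ℤ) - (n+a+1).choose a

lemma BB_step (n b : ℕ) : BB (n+1) (b+1) = BB (n+1) b + BB n (b+1) := by
  cases b with
  | zero => simp [BB]; ring
  | succ b =>
    simp only [BB]
    have e1 : n + 1 + (b+1) + 1 = (n + b + 2) + 1 := by ring
    have e2 : n + 1 + b + 1 = n + b + 2 := by ring
    have e3 : n + (b+1) + 1 = n + b + 2 := by ring
    rw [e1, e2, e3, Nat.choose_succ_succ, Nat.choose_succ_succ (n+b+2) b]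
    push_cast; ring

lemma BB_sum (n b : ℕ) : ∑ a ∈ Finset.range (b+1), BB n a = BB (n+1) b := by
  induction b with
  | zero => simp [BB]
  | succ b ih => rw [Finset.sum_range_succ, ih, BB_step]

lemma DD_eq (n : ℕ) : ∀ b ≤ n, (DD n b : ℤ) = BB n b := by
  induction n with
  | zero =>
    intro b hb
    obtain rfl : b = 0 := by omega
    simp [DD, BB, AvoidsC132, TopInc]
  | succ n ih =>
    have key : ∀ b ≤ n, (DD (n+1) b : ℤ) = BB (n+1) b := by
      intro b hb
      rw [DD_succ n b hb, ← BB_sum]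
      push_cast
      exact Finset.sum_congr rfl fun a ha => ih a (by simp at ha; omega)
    intro b hb
    rcases Nat.lt_or_ge n b with h | h
    · obtain rfl : b = n+1 := by omega
      rw [DD_top, key n le_rfl, BB_step]
      have : BB n (n+1) = 0 := by
        simp only [BB]
        rw [sub_eq_zero]
        norm_cast
        exact Nat.choose_symm_of_eq_add (by ring)
      omega
    · exact key b h

lemma BB_catalan (n : ℕ) : BB n n = catalan n := by
  cases n with
  | zero => simp [BB]
  | succ n =>
    have h := succ_mul_catalan_eq_centralBinom (n+1)
    have h2 := Nat.choose_succ_right_eq (2*(n+1)) n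
    rw [Nat.centralBinom] at h
    simp only [BB]
    have e : n + 1 + n + 1 = 2*(n+1) := by ring
    rw [e]
    have e2 : 2*(n+1) - n = n+2 := by omega
    rw [e2] at h2
    have h3 : ((n:ℤ)+2) ≠ 0 := by positivity
    apply mul_left_cancel₀ h3
    zify at h h2
    linear_combination h2 - h

lemma card_avoid (n : ℕ) :
    Nat.card {π : Equiv.Perm (Fin n) // AvoidsC132 π} = catalan n := by
  classical
  have h : (DD n n : ℤ) = catalan n := by rw [DD_eq n n le_rfl, BB_catalan]
  have h' : DD n n = catalan n := by exact_mod_cast h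
  rw [← h', Nat.card_eq_fintype_card, Fintype.card_subtype, Finset.card_filter]
  unfold DD
  refine Finset.sum_congr rfl fun σ _ => if_congr ?_ rfl rfl
  have : TopInc σ n := fun i j _ hi => absurd (σ i).2 (by omega)
  exact (and_iff_left this).symm

/-- stripping the first letter -/
lemma begins_insP {n k : ℕ} (a : Fin (n+2)) (σ : Equiv.Perm (Fin (n+1))) :
    (AvoidsC132 (insP a σ) ∧ BeginsInc (insP a σ) (k+2)) ↔
      a = (σ 0).castSucc ∧ AvoidsC132 σ ∧ BeginsInc σ (k+1) := by
  rw [avoids_insP]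
  constructor
  · rintro ⟨⟨h, ht⟩, hkn, hb⟩
    refine ⟨?_, h, by omega, ?_⟩
    · have h1 := hb 0 (Fin.succ 0) (by simp) (by simp)
      rw [insP_zero, insP_succ, Fin.lt_succAbove_iff_le_castSucc] at h1
      by_contra hc
      have h2 : (a : ℕ) < σ 0 := lt_of_le_of_ne h1 fun e => hc (Fin.ext e)
      have han : (a : ℕ) < n + 1 := h2.trans (σ 0).2
      set j := σ.symm ⟨a, han⟩ with hj
      have hσj : σ j = ⟨a, han⟩ := by simp [hj]
      have hj0 : j ≠ 0 := by
        intro e; rw [e] at hσj; rw [hσj] at h2; simp at h2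
      have := ht 0 j (Fin.pos_of_ne_zero hj0) h2.le (by rw [hσj])
      rw [hσj, Fin.lt_def] at this
      simp only at this
      omega
    · intro i j hij hj
      have := hb i.succ j.succ (by simpa) (by simp; omega)
      simpa [insP_succ] using this
  · rintro ⟨rfl, h, hkn, hb⟩
    refine ⟨⟨h, ?_⟩, by omega, ?_⟩
    · intro i j hij hi hj
      simp only [Fin.val_castSucc] at hi hj
      by_contra hc
      have hne : σ i ≠ σ j := fun e => hij.ne (σ.injective e)
      have hlt : σ j < σ i := lt_of_le_of_ne (not_lt.1 hc) hne.symm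
      have hj0 : σ 0 ≠ σ j := fun e => Fin.ne_zero_of_lt hij (σ.injective e).symm
      have h0j : σ 0 < σ j := lt_of_le_of_ne hj hj0
      have hi0 : i ≠ 0 := by
        rintro rfl; exact absurd hlt (not_lt.2 h0j.le)
      exact h ⟨0, i, j, Fin.pos_of_ne_zero hi0, hij, h0j, hlt⟩
    · intro i j hij hj
      obtain ⟨j, rfl⟩ := Fin.exists_succ_eq.2 (Fin.ne_zero_of_lt hij)
      have hj' : (j : ℕ) < k + 1 := by simp at hj; omega
      induction i using Fin.cases with
      | zero =>
        rw [insP_zero, insP_succ, Fin.lt_succAbove_iff_le_castSucc, Fin.castSucc_le_castSucc_iff]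
        rcases eq_or_ne j 0 with rfl | hj0
        · exact le_rfl
        · exact (hb 0 j (Fin.pos_of_ne_zero hj0) hj').le
      | succ i =>
        rw [insP_succ, insP_succ, Fin.succAbove_lt_succAbove_iff]
        exact hb i j (by simpa using hij) hj'

lemma card_step (n k : ℕ) :
    Nat.card {π : Equiv.Perm (Fin (n+2)) // AvoidsC132 π ∧ BeginsInc π (k+2)}
      = Nat.card {π : Equiv.Perm (Fin (n+1)) // AvoidsC132 π ∧ BeginsInc π (k+1)} := by
  symm
  refine Nat.card_congr (Equiv.ofBijective
    (fun σ => ⟨insP (σ.1 0).castSucc σ.1, (begins_insP _ _).2 ⟨rfl, σ.2⟩⟩) ⟨?_, ?_⟩)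
  · rintro ⟨σ, hσ⟩ ⟨τ, hτ⟩ h
    have h1 := insP_inj (a₁ := ((σ 0).castSucc, σ)) (a₂ := ((τ 0).castSucc, τ))
      (congrArg Subtype.val h)
    exact Subtype.ext (congrArg Prod.snd h1)
  · rintro ⟨π, hπ⟩
    obtain ⟨⟨a, σ⟩, rfl⟩ := (insE (n+1)).surjective π
    rw [insE_apply] at hπ
    obtain ⟨h1, h2⟩ := (begins_insP _ _).1 hπ
    refine ⟨⟨σ, h2⟩, Subtype.ext ?_⟩
    simp only [insE_apply]
    simp only at h1
    rw [h1]

lemma card_add (m k : ℕ) :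
    Nat.card {π : Equiv.Perm (Fin (m+k+1)) // AvoidsC132 π ∧ BeginsInc π (k+1)}
      = catalan (m+1) := by
  induction k with
  | zero =>
    rw [← card_avoid]
    refine Nat.card_congr (Equiv.subtypeEquivRight fun π => ?_)
    refine and_iff_left ⟨by omega, fun i j hij hj => ?_⟩
    rw [Fin.lt_def] at hij
    omega
  | succ k ih => rw [← ih]; exact card_step (m+k) k

theorem avoidC132_beginInc_count (n k : ℕ) (hk : 1 ≤ k) (hkn : k ≤ n) :
    Nat.card {π : Equiv.Perm (Fin n) // AvoidsC132 π ∧ BeginsInc π k}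
      = catalan (n - k + 1) := by
  obtain ⟨k, rfl⟩ : ∃ k', k = k' + 1 := ⟨k - 1, by omega⟩
  obtain ⟨m, rfl⟩ : ∃ m, n = m + k + 1 := ⟨n - (k+1), by omega⟩
  rw [card_add]
  congr 1
  omega
end
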